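/- For all sequences (ℓ_i), (λ_i) ∈ 𝕽 there exist a sequence (δ_i) ∈ 𝕽 and a constant C ≥ 0 such that N_{(ℓ_i)}(ρ) + N_{(λ_i)}(ρ) ≤ N_{(δ_i)}(ρ) + C for all ρ > 0. -/

import Mathlib

open scoped BigOperators

/-- `log₊ x = max (log x) 0`. -/
noncomputable def logPlus (x : ℝ) : ℝ := max (Real.log x) 0

/-- The associated function `M(ρ) = sup_p log₊ (ρ^p / M_p)`. -/
noncomputable def assocM (Mp : ℕ → ℝ) (ρ : ℝ) : ℝ :=
  ⨆ p : ℕ, logPlus (ρ ^ p / Mp p)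

/-- `N_{(r_i)}(ρ) = sup_p log₊ (ρ^p / (M_p · Π_{i=1}^p r_i))`
(the sequence `(r_i)_{i≥1}` is indexed here by `ℕ`, `r 0 = r_1`, etc.). -/
noncomputable def assocN (Mp : ℕ → ℝ) (r : ℕ → ℝ) (ρ : ℝ) : ℝ :=
  ⨆ p : ℕ, logPlus (ρ ^ p / (Mp p * ∏ i ∈ Finset.range p, r i))

/-- `(r_i) ∈ 𝕽`: positive, monotonically increasing, tending to infinity. -/
def InRcal (r : ℕ → ℝ) : Prop :=
  (∀ i, 0 < r i) ∧ Monotone r ∧ Filter.Tendsto r Filter.atTop Filter.atTop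

/-- Condition (M.1): logarithmic convexity. -/
def CondM1 (Mp : ℕ → ℝ) : Prop :=
  ∀ p : ℕ, (Mp (p + 1)) ^ 2 ≤ Mp p * Mp (p + 2)

/-- Condition (M.2) with constants `c0, H`. -/
def CondM2 (Mp : ℕ → ℝ) (c0 H : ℝ) : Prop :=
  ∀ p q : ℕ, Mp (p + q) ≤ c0 * H ^ (p + q) * Mp p * Mp q

/-- Condition (M.2). -/
def CondM2' (Mp : ℕ → ℝ) : Prop :=
  ∃ c0 H : ℝ, 1 ≤ c0 ∧ 1 ≤ H ∧ CondM2 Mp c0 H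

/-- Condition (M.3): `Σ_{j=p+1}^∞ M_{j-1}/M_j ≤ c0 · p · M_p / M_{p+1}`. -/
def CondM3 (Mp : ℕ → ℝ) : Prop :=
  ∃ c0 : ℝ, 1 ≤ c0 ∧ ∀ p : ℕ, 1 ≤ p →
    ∑' n : ℕ, Mp (p + n) / Mp (p + n + 1) ≤ c0 * p * Mp p / Mp (p + 1)

lemma CondM1.mul_le_succ {Mp : ℕ → ℝ} (hMpos : ∀ p, 0 < Mp p) (hM0 : Mp 0 = 1)
    (hM1 : CondM1 Mp) (p : ℕ) : Mp 1 * Mp p ≤ Mp (p + 1) := by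
  induction p with
  | zero => simp [hM0]
  | succ p ih =>
    have h1 := hM1 p
    have h2 := mul_le_mul_of_nonneg_left ih (hMpos (p + 1)).le
    refine le_of_mul_le_mul_left ?_ (hMpos p)
    calc Mp p * (Mp 1 * Mp (p + 1)) = Mp (p + 1) * (Mp 1 * Mp p) := by ring
      _ ≤ Mp (p + 1) * Mp (p + 1) := h2
      _ = Mp (p + 1) ^ 2 := by ring
      _ ≤ Mp p * Mp (p + 1 + 1) := h1

lemma logPlus_le_logPlus {x y : ℝ} (hx : 0 < x) (h : x ≤ y) : logPlus x ≤ logPlus y :=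
  max_le_max (Real.log_le_log hx h) le_rfl

lemma exists_forall_le_of_eventually_succ_le {u : ℕ → ℝ} (hu : ∀ p, 0 < u p) {N : ℕ}
    (h : ∀ p, N ≤ p → u (p + 1) ≤ u p) : ∃ B, ∀ p, u p ≤ B := by
  have hsum : ∀ p, p ≤ N → u p ≤ ∑ i ∈ Finset.range (N + 1), u i := fun p hp =>
    Finset.single_le_sum (f := u) (fun i _ => (hu i).le) (Finset.mem_range.2 (by omega))
  refine ⟨∑ i ∈ Finset.range (N + 1), u i, fun p => ?_⟩
  rcases le_total p N with hp | hp
  · exact hsum p hp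
  · have hN : u p ≤ u N := by
      induction p, hp using Nat.le_induction with
      | base => exact le_rfl
      | succ p hp ih => exact (h p hp).trans ih
    exact hN.trans (hsum N le_rfl)

lemma bddAbove_range_assocN {Mp : ℕ → ℝ} (hMpos : ∀ p, 0 < Mp p) (hM0 : Mp 0 = 1)
    (hM1 : CondM1 Mp) {r : ℕ → ℝ} (hr : InRcal r) {ρ : ℝ} (hρ : 0 < ρ) :
    BddAbove (Set.range fun p : ℕ =>
      logPlus (ρ ^ p / (Mp p * ∏ i ∈ Finset.range p, r i))) := by
  obtain ⟨hrpos, -, hrlim⟩ := hr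
  have hprod : ∀ p, 0 < ∏ i ∈ Finset.range p, r i := fun p =>
    Finset.prod_pos fun i _ => hrpos i
  have hu : ∀ p, 0 < ρ ^ p / (Mp p * ∏ i ∈ Finset.range p, r i) := fun p =>
    div_pos (pow_pos hρ p) (mul_pos (hMpos p) (hprod p))
  obtain ⟨N, hN⟩ := Filter.eventually_atTop.1 (hrlim.eventually_ge_atTop (ρ / Mp 1))
  obtain ⟨B, hB⟩ := exists_forall_le_of_eventually_succ_le hu (N := N) (by
    intro p hp
    have h1 : ρ ≤ r p * Mp 1 := (div_le_iff₀ (hMpos 1)).1 (hN p hp)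
    have h2 : ρ * Mp p ≤ Mp (p + 1) * r p :=
      calc ρ * Mp p ≤ r p * Mp 1 * Mp p := mul_le_mul_of_nonneg_right h1 (hMpos p).le
        _ = Mp 1 * Mp p * r p := by ring
        _ ≤ Mp (p + 1) * r p :=
          mul_le_mul_of_nonneg_right (hM1.mul_le_succ hMpos hM0 p) (hrpos p).le
    rw [div_le_div_iff₀ (mul_pos (hMpos _) (hprod _)) (mul_pos (hMpos _) (hprod _)),
      Finset.prod_range_succ]
    have h3 := mul_le_mul_of_nonneg_left h2 (mul_pos (pow_pos hρ p) (hprod p)).le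
    calc _ = ρ ^ p * (∏ i ∈ Finset.range p, r i) * (ρ * Mp p) := by ring
      _ ≤ _ := h3
      _ = _ := by ring)
  refine ⟨logPlus B, ?_⟩
  rintro _ ⟨p, rfl⟩
  exact logPlus_le_logPlus (hu p) (hB p)

lemma InRcal.min {r s : ℕ → ℝ} (hr : InRcal r) (hs : InRcal s) :
    InRcal fun i => min (r i) (s i) :=
  ⟨fun i => lt_min (hr.1 i) (hs.1 i), hr.2.1.min hs.2.1,
    Filter.tendsto_atTop.2 fun b =>
      ((hr.2.2.eventually_ge_atTop b).and (hs.2.2.eventually_ge_atTop b)).mono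
        fun _ h => le_min h.1 h.2⟩

lemma InRcal.half_div {r : ℕ → ℝ} (hr : InRcal r) {H : ℝ} (hH : 0 < H) :
    InRcal fun i => r (i / 2) / H :=
  ⟨fun _ => div_pos (hr.1 _) hH,
    fun _ _ h => div_le_div_of_nonneg_right (hr.2.1 (Nat.div_le_div_right h)) hH.le,
    (hr.2.2.comp (Nat.tendsto_div_const_atTop two_ne_zero)).atTop_div_const hH⟩

/-- Repeating every term of an increasing sequence twice gives the smallest possible products of
initial segments of two copies of the sequence. -/
lemma prod_range_half_le {κ : ℕ → ℝ} (hpos : ∀ i, 0 < κ i) (hmono : Monotone κ) (p q : ℕ) :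
    ∏ i ∈ Finset.range (p + q), κ (i / 2) ≤
      (∏ i ∈ Finset.range p, κ i) * ∏ i ∈ Finset.range q, κ i := by
  wlog hqp : q ≤ p generalizing p q
  · rw [add_comm, mul_comm]
    exact this q p (by omega)
  induction p, hqp using Nat.le_induction with
  | base =>
    refine le_of_eq ?_
    induction q with
    | zero => simp
    | succ q ih =>
      rw [show q + 1 + (q + 1) = q + q + 1 + 1 by ring, Finset.prod_range_succ,
        Finset.prod_range_succ, ih, Finset.prod_range_succ, show (q + q) / 2 = q by omega,
        show (q + q + 1) / 2 = q by omega]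
      ring
  | succ p hp ih =>
    rw [show p + 1 + q = p + q + 1 by ring, Finset.prod_range_succ, Finset.prod_range_succ]
    calc _ ≤ (∏ i ∈ Finset.range p, κ i) * (∏ i ∈ Finset.range q, κ i) * κ p :=
          mul_le_mul ih (hmono (by omega)) (hpos _).le
            (mul_pos (Finset.prod_pos fun i _ => hpos i)
              (Finset.prod_pos fun i _ => hpos i)).le
      _ = _ := by ring

/-- A term of the supremum defining `assocN` is the logarithm of a term, since the zeroth
term is `1`. -/
lemma exists_logPlus_eq_log {Mp : ℕ → ℝ} (hM0 : Mp 0 = 1) (r : ℕ → ℝ) (ρ : ℝ) (p : ℕ) :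
    ∃ k, logPlus (ρ ^ p / (Mp p * ∏ i ∈ Finset.range p, r i)) =
      Real.log (ρ ^ k / (Mp k * ∏ i ∈ Finset.range k, r i)) := by
  rcases le_total 0 (Real.log (ρ ^ p / (Mp p * ∏ i ∈ Finset.range p, r i))) with h | h
  · exact ⟨p, max_eq_left h⟩
  · exact ⟨0, by simpa [logPlus, hM0] using h⟩

theorem stmt5 (Mp : ℕ → ℝ) (hMpos : ∀ p, 0 < Mp p) (hM0 : Mp 0 = 1)
    (hM1 : CondM1 Mp) (hM2 : CondM2' Mp)
    (ell lam : ℕ → ℝ) (hell : InRcal ell) (hlam : InRcal lam) :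
    ∃ δ : ℕ → ℝ, InRcal δ ∧ ∃ C : ℝ, 0 ≤ C ∧
      ∀ ρ : ℝ, 0 < ρ →
        assocN Mp ell ρ + assocN Mp lam ρ ≤ assocN Mp δ ρ + C := by
  obtain ⟨c0, H, hc0, hH, hM2⟩ := hM2
  have hH0 : 0 < H := one_pos.trans_le hH
  have hc : 0 < c0 := one_pos.trans_le hc0
  have hκ := hell.min hlam
  have hδ := hκ.half_div hH0
  refine ⟨_, hδ, Real.log c0, Real.log_nonneg hc0, fun ρ hρ => ?_⟩
  set κ : ℕ → ℝ := fun i => min (ell i) (lam i) with hκdef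
  set δ : ℕ → ℝ := fun i => κ (i / 2) / H with hδdef
  have hprod : ∀ {r : ℕ → ℝ}, InRcal r → ∀ p, 0 < ∏ i ∈ Finset.range p, r i :=
    fun hr p => Finset.prod_pos fun i _ => hr.1 i
  have hterm : ∀ {r : ℕ → ℝ}, InRcal r → ∀ p,
      0 < ρ ^ p / (Mp p * ∏ i ∈ Finset.range p, r i) :=
    fun hr p => div_pos (pow_pos hρ p) (mul_pos (hMpos p) (hprod hr p))
  have hδprod : ∀ p q, H ^ (p + q) * ∏ i ∈ Finset.range (p + q), δ i ≤
      (∏ i ∈ Finset.range p, ell i) * ∏ i ∈ Finset.range q, lam i := by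
    intro p q
    calc H ^ (p + q) * ∏ i ∈ Finset.range (p + q), δ i
        = ∏ i ∈ Finset.range (p + q), κ (i / 2) := by
          rw [hδdef, Finset.prod_div_distrib, Finset.prod_const, Finset.card_range]
          field_simp
      _ ≤ (∏ i ∈ Finset.range p, κ i) * ∏ i ∈ Finset.range q, κ i :=
          prod_range_half_le hκ.1 hκ.2.1 p q
      _ ≤ _ := mul_le_mul
          (Finset.prod_le_prod (fun i _ => (hκ.1 i).le) fun i _ => min_le_left _ _)
          (Finset.prod_le_prod (fun i _ => (hκ.1 i).le) fun i _ => min_le_right _ _)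
          (hprod hκ q).le (hprod hell p).le
  have hlog : ∀ p q, Real.log (ρ ^ p / (Mp p * ∏ i ∈ Finset.range p, ell i)) +
      Real.log (ρ ^ q / (Mp q * ∏ i ∈ Finset.range q, lam i)) ≤ assocN Mp δ ρ + Real.log c0 := by
    intro p q
    have hle : ρ ^ p / (Mp p * ∏ i ∈ Finset.range p, ell i) *
        (ρ ^ q / (Mp q * ∏ i ∈ Finset.range q, lam i)) ≤
        ρ ^ (p + q) / (Mp (p + q) * ∏ i ∈ Finset.range (p + q), δ i) * c0 := by
      rw [div_mul_div_comm, ← pow_add, div_mul_eq_mul_div, div_le_div_iff₀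
        (mul_pos (mul_pos (hMpos p) (hprod hell p)) (mul_pos (hMpos q) (hprod hlam q)))
        (mul_pos (hMpos _) (hprod hδ _)), mul_assoc]
      refine mul_le_mul_of_nonneg_left ?_ (pow_pos hρ _).le
      calc Mp (p + q) * ∏ i ∈ Finset.range (p + q), δ i
          ≤ c0 * H ^ (p + q) * Mp p * Mp q * ∏ i ∈ Finset.range (p + q), δ i :=
            mul_le_mul_of_nonneg_right (hM2 p q) (hprod hδ _).le
        _ = c0 * Mp p * Mp q * (H ^ (p + q) * ∏ i ∈ Finset.range (p + q), δ i) := by ring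
        _ ≤ c0 * Mp p * Mp q *
            ((∏ i ∈ Finset.range p, ell i) * ∏ i ∈ Finset.range q, lam i) :=
            mul_le_mul_of_nonneg_left (hδprod p q)
              (mul_pos (mul_pos hc (hMpos p)) (hMpos q)).le
        _ = _ := by ring
    rw [← Real.log_mul (hterm hell p).ne' (hterm hlam q).ne']
    refine (Real.log_le_log (mul_pos (hterm hell p) (hterm hlam q)) hle).trans ?_
    rw [Real.log_mul (hterm hδ _).ne' hc.ne']
    gcongr
    exact (le_max_left _ _).trans
      (le_ciSup (bddAbove_range_assocN hMpos hM0 hM1 hδ hρ) (p + q))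
  refine le_sub_iff_add_le.1 (ciSup_le fun p => le_sub_comm.1 (ciSup_le fun q => ?_))
  obtain ⟨p', hp⟩ := exists_logPlus_eq_log hM0 ell ρ p
  obtain ⟨q', hq⟩ := exists_logPlus_eq_log hM0 lam ρ q
  rw [hp, hq]
  linarith [hlog p' q']
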